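/- Weil bound for character sums over primes: let B ∈ F_q[x] be monic of positive degree and not a perfect square, q odd. Then for every n ≥ 1, |Σ_{P monic prime, deg P = n} (B/P)| ≤ C · (deg B / n) · q^{n/2} for an absolute constant C (e.g. C can be taken so the bound reads ≤ ((deg B + 1)/n) q^{n/2} + 2q^{n/2}/n, or any fixed constant). -/

import Mathlib

open Polynomial UniqueFactorizationMonoid Finset

noncomputable section
open scoped Classical

variable (F : Type) [Field F] [Fintype F] [DecidableEq F]

/-- The Möbius function of `F_q[x]`. -/
def polyMu (A : F[X]) : ℤ :=
  if Squarefree A then (-1) ^ Multiset.card (normalizedFactors A) else 0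

/-- The quadratic residue symbol `(f/P)` for a monic prime `P`. -/
def legSym (f P : F[X]) : ℤ :=
  if P ∣ f then 0 else if ∃ g : F[X], P ∣ (g ^ 2 - f) then 1 else -1

/-- The Jacobi symbol `(f/Q)` for monic `Q`. -/
def jacSym (f Q : F[X]) : ℤ :=
  ((normalizedFactors Q).map (legSym F f)).prod

/-- `A_D(β) = Σ_{B monic, deg B = β} (D/B)`. -/
def charSum (D : F[X]) (β : ℕ) : ℤ :=
  ∑ᶠ B ∈ {B : F[X] | B.Monic ∧ B.natDegree = β}, jacSym F D B

/-- `σ(f,α) = Σ_{A monic, deg A = α, gcd(A,f)=1} μ(A)`. -/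
def sigmaMu (f : F[X]) (α : ℕ) : ℤ :=
  ∑ᶠ A ∈ {A : F[X] | A.Monic ∧ A.natDegree = α ∧ IsCoprime A f}, polyMu F A

/-- The von Mangoldt function of `F_q[x]`. -/
def polyLambda (f : F[X]) : ℕ :=
  if (normalizedFactors f).toFinset.card = 1 then
    (normalizedFactors f).toFinset.sum natDegree else 0

set_option linter.unusedSectionVars false

section Stepanov

variable {K : Type*} [Field K]

lemma pow_sub_dvd_hasseDeriv_pow (f : K[X]) (N k : ℕ) :
    f ^ (N - k) ∣ hasseDeriv k (f ^ N) := by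
  induction N generalizing k with
  | zero => simp
  | succ N ih =>
    rw [pow_succ', hasseDeriv_mul]
    refine Finset.dvd_sum fun ij hij => ?_
    obtain ⟨i, j⟩ := ij
    rw [HasAntidiagonal.mem_antidiagonal] at hij
    rcases Nat.eq_zero_or_pos i with rfl | hi
    · obtain rfl : j = k := by simpa using hij
      rw [hasseDeriv_zero, LinearMap.id_apply]
      refine (pow_dvd_pow f (show N + 1 - j ≤ 1 + (N - j) by omega)).trans ?_
      rw [pow_add, pow_one]
      exact mul_dvd_mul_left _ (ih j)
    · exact ((pow_dvd_pow f (by omega)).trans (ih j)).mul_left _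

lemma pow_sub_dvd_hasseDeriv (f p : K[X]) (N k : ℕ) :
    f ^ (N - k) ∣ hasseDeriv k (f ^ N * p) := by
  rw [hasseDeriv_mul]
  refine Finset.dvd_sum fun ij hij => ?_
  rw [HasAntidiagonal.mem_antidiagonal] at hij
  exact ((pow_dvd_pow f (by omega)).trans (pow_sub_dvd_hasseDeriv_pow f N ij.1)).mul_right _

/-- The cofactor of `f ^ (N - k)` in the `k`-th Hasse derivative of `f ^ N * p`. -/
def hasseCofactor (f : K[X]) (N k : ℕ) (p : K[X]) : K[X] :=
  hasseDeriv k (f ^ N * p) /ₘ f ^ (N - k)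

lemma pow_mul_hasseCofactor {f : K[X]} (hf : f.Monic) (N k : ℕ) (p : K[X]) :
    f ^ (N - k) * hasseCofactor f N k p = hasseDeriv k (f ^ N * p) :=
  EuclideanDomain.mul_div_cancel' (pow_ne_zero _ hf.ne_zero) (pow_sub_dvd_hasseDeriv f p N k) ▸ by
    rw [hasseCofactor, divByMonic_eq_div _ (hf.pow _)]

lemma hasseCofactor_add {f : K[X]} (hf : f.Monic) (N k : ℕ) (p q : K[X]) :
    hasseCofactor f N k (p + q) = hasseCofactor f N k p + hasseCofactor f N k q := by
  apply mul_left_cancel₀ (pow_ne_zero (N - k) hf.ne_zero)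
  simp only [mul_add, pow_mul_hasseCofactor hf, map_add]

lemma hasseCofactor_smul {f : K[X]} (hf : f.Monic) (N k : ℕ) (c : K) (p : K[X]) :
    hasseCofactor f N k (c • p) = c • hasseCofactor f N k p := by
  apply mul_left_cancel₀ (pow_ne_zero (N - k) hf.ne_zero)
  simp only [mul_smul_comm, pow_mul_hasseCofactor hf, map_smul]

lemma degree_hasseCofactor_lt {f : K[X]} (hf : f.Monic) {N k : ℕ} (hk : k ≤ N) {A : ℕ} {p : K[X]}
    (hp : p.degree < A) : (hasseCofactor f N k p).degree < (A + k * f.natDegree : ℕ) := by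
  by_cases h0 : hasseCofactor f N k p = 0
  · rw [h0, degree_zero]; exact WithBot.bot_lt_coe _
  have hp0 : p ≠ 0 := by
    rintro rfl
    exact h0 (by simp [hasseCofactor])
  rw [← natDegree_lt_iff_degree_lt h0]
  rw [← natDegree_lt_iff_degree_lt hp0] at hp
  have h1 : (f ^ (N - k) * hasseCofactor f N k p).natDegree ≤ N * f.natDegree + p.natDegree := by
    rw [pow_mul_hasseCofactor hf]
    refine (natDegree_hasseDeriv_le _ _).trans ((Nat.sub_le _ _).trans ?_)
    refine natDegree_mul_le.trans ?_
    rw [natDegree_pow]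
  rw [natDegree_mul (pow_ne_zero _ hf.ne_zero) h0, natDegree_pow] at h1
  have h2 : N * f.natDegree = (N - k) * f.natDegree + k * f.natDegree := by
    rw [← add_mul, Nat.sub_add_cancel hk]
  omega

lemma Polynomial.Monic.eq_sq_of_mul_sq_eq {f r s : K[X]} {c : K} (hf : f.Monic) (hr : r ≠ 0)
    (h : f * r ^ 2 = C c * s ^ 2) : ∃ t, f = t ^ 2 := by
  have hc : c ≠ 0 := by
    rintro rfl
    simp [hf.ne_zero, hr] at h
  have h1 : r ^ 2 ∣ s ^ 2 := by
    refine ⟨C c⁻¹ * f, ?_⟩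
    have : s ^ 2 = C c⁻¹ * (C c * s ^ 2) := by
      rw [← mul_assoc, ← C_mul, inv_mul_cancel₀ hc, C_1, one_mul]
    rw [this, ← h]; ring
  obtain ⟨t, rfl⟩ := (IsIntegrallyClosed.pow_dvd_pow_iff two_ne_zero).1 h1
  have h2 : f = C c * t ^ 2 := by
    apply mul_right_cancel₀ (pow_ne_zero 2 hr)
    rw [h]; ring
  have h3 : c * t.leadingCoeff ^ 2 = 1 := by
    have := hf.leadingCoeff
    rwa [h2, leadingCoeff_mul, leadingCoeff_C, leadingCoeff_pow] at this
  have h4 : t.leadingCoeff ≠ 0 := by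
    rintro h0; simp [h0] at h3
  refine ⟨C t.leadingCoeff⁻¹ * t, ?_⟩
  rw [mul_pow, ← C_pow, h2]
  congr 2
  field_simp
  exact h3

lemma X_sub_C_pow_dvd_of_eval_hasseDeriv {p : K[X]} {x : K} {l : ℕ}
    (h : ∀ k < l, (hasseDeriv k p).eval x = 0) : (X - C x) ^ l ∣ p := by
  have h1 : X ^ l ∣ taylor x p := by
    rw [X_pow_dvd_iff]
    intro k hk
    rw [taylor_coeff, h k hk]
  obtain ⟨w, hw⟩ := h1
  refine ⟨taylor (-x) w, ?_⟩
  have := congrArg (taylor (-x)) hw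
  rw [taylor_taylor, neg_add_cancel, taylor_zero, taylor_mul, taylor_X_pow] at this
  simpa [sub_eq_add_neg] using this

variable [Fintype K]

lemma sub_C_pow_card (f : K[X]) (x : K) :
    (f - C x) ^ Fintype.card K = f ^ Fintype.card K - C x := by
  obtain ⟨p, hp⟩ := CharP.exists K
  obtain ⟨n, hpp, hn⟩ := FiniteField.card K p
  have : Fact p.Prime := ⟨hpp⟩
  conv_rhs => rw [← FiniteField.pow_card x, C_pow]
  rw [hn]
  exact sub_pow_char_pow f (C x) n

lemma X_pow_card_dvd_pow_card_sub (f : K[X]) :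
    (X : K[X]) ^ Fintype.card K ∣ f ^ Fintype.card K - C (f.eval 0) := by
  have h : (X : K[X]) ∣ f - C (f.eval 0) := by
    rw [X_dvd_iff]; simp [coeff_zero_eq_eval_zero]
  rw [← sub_C_pow_card]
  exact pow_dvd_pow_of_dvd h (Fintype.card K)

/-- If `r + s f ^ c` vanishes to order `q = 2 c + 1` at the origin and `r`, `s` have small degree,
then `r = s = 0` unless `f` is a square. -/
lemma eq_zero_of_X_pow_card_dvd {f : K[X]} (hf : f.Monic) (hf0 : f.eval 0 ≠ 0)
    (hsq : ¬ ∃ t, f = t ^ 2) {c A : ℕ} (hA0 : 0 < A) (hc : Fintype.card K = 2 * c + 1)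
    (hA : 2 * A + f.natDegree ≤ Fintype.card K) {r s : K[X]} (hr : r.degree < A)
    (hs : s.degree < A) (h : (X : K[X]) ^ Fintype.card K ∣ r + s * f ^ c) : r = 0 ∧ s = 0 := by
  have h1 : (X : K[X]) ^ Fintype.card K ∣ f * r ^ 2 - C (f.eval 0) * s ^ 2 := by
    have e : f * r ^ 2 - C (f.eval 0) * s ^ 2 = (r + s * f ^ c) * (f * (r - s * f ^ c)) +
        (f ^ Fintype.card K - C (f.eval 0)) * s ^ 2 := by
      rw [hc]; ring
    rw [e]
    exact (h.mul_right _).add ((X_pow_card_dvd_pow_card_sub f).mul_right _)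
  have key : ∀ t : K[X], t.degree < A → (t ^ 2).natDegree + f.natDegree < Fintype.card K := by
    intro t ht
    rw [natDegree_pow]
    by_cases h0 : t = 0
    · simp only [h0, natDegree_zero]; omega
    · rw [← natDegree_lt_iff_degree_lt h0] at ht
      omega
  have h2 : f * r ^ 2 - C (f.eval 0) * s ^ 2 = 0 := by
    by_contra hne
    have h3 := natDegree_le_of_dvd h1 hne
    rw [natDegree_X_pow] at h3
    have h4 := natDegree_sub_le (f * r ^ 2) (C (f.eval 0) * s ^ 2)
    have h5 := natDegree_mul_le (p := f) (q := r ^ 2)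
    have h6 := natDegree_mul_le (p := C (f.eval 0)) (q := s ^ 2)
    rw [natDegree_C] at h6
    have := key r hr
    have := key s hs
    omega
  rw [sub_eq_zero] at h2
  have hr0 : r = 0 := by
    by_contra hr0
    exact hsq (hf.eq_sq_of_mul_sq_eq hr0 h2)
  refine ⟨hr0, ?_⟩
  simpa [hr0, hf0] using h2

lemma eq_zero_of_sum_mul_X_pow_eq_zero {f : K[X]} (hf : f.Monic) (hf0 : f.eval 0 ≠ 0)
    (hsq : ¬ ∃ t, f = t ^ 2) {c A J : ℕ} (hA0 : 0 < A) (hc : Fintype.card K = 2 * c + 1)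
    (hA : 2 * A + f.natDegree ≤ Fintype.card K) {r s : Fin J → K[X]}
    (hr : ∀ j, (r j).degree < A) (hs : ∀ j, (s j).degree < A)
    (h : ∑ j, (r j + s j * f ^ c) * X ^ (Fintype.card K * j) = 0) (j : Fin J) :
    r j = 0 ∧ s j = 0 := by
  induction j using WellFoundedLT.induction with
  | ind j ih =>
    refine eq_zero_of_X_pow_card_dvd hf hf0 hsq hA0 hc hA (hr j) (hs j) ?_
    have hX : (X : K[X]) ^ (Fintype.card K * (j : ℕ)) ≠ 0 := pow_ne_zero _ X_ne_zero
    rw [← mul_dvd_mul_iff_right hX]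
    rw [← Finset.add_sum_erase _ _ (Finset.mem_univ j)] at h
    rw [eq_neg_of_add_eq_zero_left h, dvd_neg]
    refine Finset.dvd_sum fun i hi => ?_
    rcases lt_or_gt_of_ne (Finset.ne_of_mem_erase hi) with hij | hij
    · simp [ih i hij]
    · refine Dvd.dvd.mul_left ?_ _
      rw [← pow_add]
      refine pow_dvd_pow _ ?_
      have : (j : ℕ) + 1 ≤ i := hij
      nlinarith

/-- Stepanov's auxiliary polynomial vanishes to order `l` at a point where `f` is nonzero. -/
lemma X_sub_C_pow_dvd_auxiliary {f : K[X]} (hf : f.Monic) {c J l : ℕ} (hl : l ≤ Fintype.card K)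
    {r s : Fin J → K[X]} {a x : K} (hx : f.eval x ^ c = a) 
    (h : ∀ k < l, ∑ j : Fin J, X ^ (j : ℕ) * (hasseCofactor f l k (r j) +
      a • hasseCofactor f (l + c) k (s j)) = 0) :
    (X - C x) ^ l ∣ f ^ l * ∑ j, (r j + s j * f ^ c) * X ^ (Fintype.card K * j) := by
  have hX : (X - C x) ^ l ∣ X ^ Fintype.card K - C x := by
    rw [← sub_C_pow_card]
    exact pow_dvd_pow _ hl
  have hXj : ∀ j : ℕ, (X - C x) ^ l ∣ X ^ (Fintype.card K * j) - C (x ^ j) := by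
    intro j
    rw [pow_mul, C_pow]
    exact hX.trans (sub_dvd_pow_sub_pow _ _ j)
  have hG : (X - C x) ^ l ∣ ∑ j : Fin J, x ^ (j : ℕ) • (f ^ l * r j + f ^ (l + c) * s j) := by
    apply X_sub_C_pow_dvd_of_eval_hasseDeriv
    intro k hk
    have h1 := congrArg (eval x) (h k hk)
    rw [eval_finsetSum, eval_zero] at h1
    simp only [map_sum, map_smul, map_add, ← pow_mul_hasseCofactor hf, eval_finsetSum, eval_smul,
      eval_add, eval_mul, eval_pow, smul_eq_mul]
    rw [← mul_zero (f.eval x ^ (l - k)), ← h1, Finset.mul_sum]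
    refine Finset.sum_congr rfl fun j _ => ?_
    rw [show l + c - k = (l - k) + c by omega, pow_add, hx]
    simp only [eval_mul, eval_add, eval_pow, eval_X, eval_smul, smul_eq_mul]
    ring
  have e : f ^ l * ∑ j, (r j + s j * f ^ c) * X ^ (Fintype.card K * j) =
      ∑ j : Fin J, x ^ (j : ℕ) • (f ^ l * r j + f ^ (l + c) * s j) +
      ∑ j : Fin J, (X ^ (Fintype.card K * j) - C (x ^ (j : ℕ))) *
        (f ^ l * r j + f ^ (l + c) * s j) := by
    rw [Finset.mul_sum, ← Finset.sum_add_distrib]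
    refine Finset.sum_congr rfl fun j _ => ?_
    rw [smul_eq_C_mul]
    ring
  rw [e]
  exact hG.add (Finset.dvd_sum fun j _ => (hXj j).mul_right _)

/-- Stepanov's bound for the number of points at which `f ^ c` takes a given value. -/
theorem stepanov_count {f : K[X]} (hf : f.Monic) (hf0 : f.eval 0 ≠ 0)
    (hsq : ¬ ∃ t, f = t ^ 2) {c A J l : ℕ} (hA0 : 0 < A) (hc : Fintype.card K = 2 * c + 1)
    (hA : 2 * A + f.natDegree ≤ Fintype.card K) (hl : l ≤ Fintype.card K)
    (hdim : l * (A + l * f.natDegree + J) < J * (2 * A)) (a : K) (S : Finset K)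
    (hS : ∀ x ∈ S, f.eval x = 0 ∨ f.eval x ^ c = a) :
    l * #S ≤ l * f.natDegree + c * f.natDegree + A + J * Fintype.card K := by
  set M := A + l * f.natDegree + J with hM
  let Φ : (Fin J → (degreeLT K A × degreeLT K A)) →ₗ[K] (Fin l → Fin M → K) :=
    { toFun := fun v k i => (∑ j : Fin J, X ^ (j : ℕ) * (hasseCofactor f l k (v j).1 +
        a • hasseCofactor f (l + c) k (v j).2)).coeff i
      map_add' := fun v w => by
        funext k i
        simp only [Pi.add_apply, ← coeff_add, ← Finset.sum_add_distrib]
        congr 1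
        refine Finset.sum_congr rfl fun j _ => ?_
        simp only [Prod.fst_add, Prod.snd_add, Submodule.coe_add, hasseCofactor_add hf, smul_add]
        ring
      map_smul' := fun b v => by
        funext k i
        simp only [Pi.smul_apply, ← coeff_smul, Finset.smul_sum, RingHom.id_apply]
        congr 1
        refine Finset.sum_congr rfl fun j _ => ?_
        simp only [Prod.smul_fst, Prod.smul_snd, Submodule.coe_smul, hasseCofactor_smul hf]
        simp only [smul_eq_C_mul]
        ring }
  have hker : LinearMap.ker Φ ≠ ⊥ := by
    apply LinearMap.ker_ne_bot_of_finrank_lt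
    have hd : Module.finrank K (degreeLT K A) = A := by
      rw [(degreeLTEquiv K A).finrank_eq, Module.finrank_fin_fun]
    have : Module.Finite K (degreeLT K A) := Module.Finite.equiv (degreeLTEquiv K A).symm
    rw [Module.finrank_pi_fintype K (M := fun _ : Fin J => degreeLT K A × degreeLT K A),
      Module.finrank_pi_fintype K (M := fun _ : Fin l => Fin M → K)]
    simp only [Module.finrank_prod, hd, Module.finrank_fin_fun, Finset.sum_const, Finset.card_univ,
      Fintype.card_fin, smul_eq_mul]
    rwa [← two_mul]
  obtain ⟨v, hv, hv0⟩ := Submodule.exists_mem_ne_zero_of_ne_bot hker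
  rw [LinearMap.mem_ker] at hv
  set r : Fin J → K[X] := fun j => (v j).1 with hr_def
  set s : Fin J → K[X] := fun j => (v j).2 with hs_def
  have hr : ∀ j, (r j).degree < A := fun j => mem_degreeLT.1 (v j).1.2
  have hs : ∀ j, (s j).degree < A := fun j => mem_degreeLT.1 (v j).2.2
  have hzero : ∀ k < l, ∑ j : Fin J, X ^ (j : ℕ) * (hasseCofactor f l k (r j) +
      a • hasseCofactor f (l + c) k (s j)) = 0 := by
    intro k hk
    have hdeg : (∑ j : Fin J, X ^ (j : ℕ) * (hasseCofactor f l k (r j) +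
      a • hasseCofactor f (l + c) k (s j))).degree < (M : WithBot ℕ) := by
      rw [← mem_degreeLT]
      refine Submodule.sum_mem _ fun j _ => ?_
      rw [mem_degreeLT]
      have hkl : k * f.natDegree ≤ l * f.natDegree := Nat.mul_le_mul_right _ hk.le
      have h1 : (hasseCofactor f l k (r j) +
          a • hasseCofactor f (l + c) k (s j)).degree < (A + l * f.natDegree : ℕ) := by
        rw [← mem_degreeLT]
        refine Submodule.add_mem _ ?_ (Submodule.smul_mem _ _ ?_) <;> rw [mem_degreeLT]
        · exact (degree_hasseCofactor_lt hf hk.le (hr j)).trans_le (by exact_mod_cast (by omega))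
        · exact (degree_hasseCofactor_lt hf (by omega) (hs j)).trans_le
            (by exact_mod_cast (by omega))
      rw [degree_mul, degree_X_pow, hM, add_comm, Nat.cast_add (A + l * f.natDegree)]
      refine WithBot.add_lt_add_of_lt_of_le ?_ h1 ?_
      · simp
      · exact_mod_cast j.2.le
    ext i
    rw [coeff_zero]
    by_cases hi : i < M
    · exact congrFun (congrFun hv ⟨k, hk⟩) ⟨i, hi⟩
    · exact coeff_eq_zero_of_degree_lt (hdeg.trans_le (by exact_mod_cast (not_lt.1 hi)))
  set G := f ^ l * ∑ j, (r j + s j * f ^ c) * X ^ (Fintype.card K * j) with hG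
  have hG0 : G ≠ 0 := by
    intro h0
    rcases mul_eq_zero.1 h0 with h0 | h0
    · exact pow_ne_zero _ hf.ne_zero h0
    · apply hv0
      funext j
      have := eq_zero_of_sum_mul_X_pow_eq_zero hf hf0 hsq hA0 hc hA hr hs h0 j
      exact Prod.ext (Subtype.ext this.1) (Subtype.ext this.2)
  have hdvd : ∏ x ∈ S, (X - C x) ^ l ∣ G := by
    refine Finset.prod_dvd_of_coprime (fun x _ y _ hxy => ?_) fun x hx => ?_
    · exact (isCoprime_X_sub_C_of_isUnit_sub (sub_ne_zero.2 hxy).isUnit).pow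
    · rcases hS x hx with h0 | h0
      · exact (pow_dvd_pow_of_dvd (dvd_iff_isRoot.2 h0) l).mul_right _
      · exact X_sub_C_pow_dvd_auxiliary hf hl h0 hzero
  have h1 := natDegree_le_of_dvd hdvd hG0
  rw [natDegree_prod_of_monic _ _ fun x _ => (monic_X_sub_C x).pow l] at h1
  simp only [natDegree_pow, natDegree_X_sub_C, mul_one, Finset.sum_const, smul_eq_mul] at h1
  have h2 : G.natDegree ≤ l * f.natDegree + (A + c * f.natDegree + Fintype.card K * J) := by
    refine natDegree_mul_le.trans (Nat.add_le_add ?_ ?_)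
    · rw [natDegree_pow]
    · refine natDegree_sum_le_of_forall_le _ _ fun j _ => ?_
      refine natDegree_mul_le.trans (Nat.add_le_add ?_ ?_)
      · refine natDegree_add_le_of_degree_le ?_ ?_
        · exact (natDegree_le_of_degree_le (hr j).le).trans (by omega)
        · refine natDegree_mul_le.trans (Nat.add_le_add ?_ ?_)
          · exact natDegree_le_of_degree_le (hs j).le
          · rw [natDegree_pow]
      · rw [natDegree_X_pow]
        exact Nat.mul_le_mul_left _ j.2.le
  rw [mul_comm l, mul_comm J]
  omega

end Stepanov

section Stepanov
variable {K : Type*} [Field K] [Fintype K]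

lemma two_mul_card_le_of_pow_eq {f : K[X]} (hf : f.Monic) (hf0 : f.eval 0 ≠ 0)
    (hsq : ¬ ∃ t, f = t ^ 2) {c : ℕ} (hc : Fintype.card K = 2 * c + 1)
    (hlarge : (4 * f.natDegree + 6) ^ 2 ≤ Fintype.card K) (a : K) (S : Finset K)
    (hS : ∀ x ∈ S, f.eval x = 0 ∨ f.eval x ^ c = a) :
    2 * #S ≤ Fintype.card K + 28 * (f.natDegree + 1) * Nat.sqrt (Fintype.card K) := by
  set m := f.natDegree with hm
  set Q := Fintype.card K with hQ
  set l := Nat.sqrt Q with hl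
  have hl1 : l * l ≤ Q := Nat.sqrt_le Q
  have hl2 : Q ≤ l * l + l + l := Nat.sqrt_le_add Q
  have hl3 : 4 * m + 6 ≤ l := by rw [hl, Nat.le_sqrt']; exact hlarge
  have hlQ : l ≤ Q := Nat.sqrt_le_self Q
  have hmQ : 4 * m + 6 ≤ Q := hl3.trans hlQ
  have hA1 : 2 * ((Q - m) / 2) + m ≤ Q := by omega
  have hA2 : Q ≤ 2 * ((Q - m) / 2) + m + 1 := by omega
  set A := (Q - m) / 2
  have hJ1 : l + (4 * m + 5) ≤ 2 * ((l + 4 * m + 6) / 2) := by omega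
  have hJ2 : 2 * ((l + 4 * m + 6) / 2) ≤ l + 4 * m + 6 := by omega
  set J := (l + 4 * m + 6) / 2
  have hJl : J ≤ l := by omega
  have hdim : l * (A + l * m + J) < J * (2 * A) := by
    have h1 : (l + (4 * m + 5)) * A ≤ 2 * J * A := Nat.mul_le_mul_right _ hJ1
    have h2 : l * J ≤ l * l := Nat.mul_le_mul_left _ hJl
    have h3 : l * l * (m + 1) ≤ Q * (m + 1) := Nat.mul_le_mul_right _ hl1
    have h4 : Q ≤ 4 * A := by omega
    have h5 : Q * (m + 1) ≤ 4 * A * (m + 1) := Nat.mul_le_mul_right _ h4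
    have h6 : 0 < A := by omega
    nlinarith
  have key := stepanov_count hf hf0 hsq (A := A) (J := J) (l := l) (by omega) hc hA1 hlQ hdim a S hS
  rw [← hm, ← hQ] at key
  have h7 : 2 * J * Q ≤ (l + 4 * m + 6) * Q := Nat.mul_le_mul_right _ hJ2
  have h8 : l * m ≤ Q * m := Nat.mul_le_mul_right _ hlQ
  have h9 : 2 * c * m ≤ Q * m := Nat.mul_le_mul_right _ (by omega)
  have h10 : l * (2 * #S) ≤ l * Q + 7 * (m + 1) * Q := by nlinarith
  have h11 : Q ≤ 4 * (l * l) := by nlinarith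
  have h12 : 7 * (m + 1) * Q ≤ 7 * (m + 1) * (4 * (l * l)) := Nat.mul_le_mul_left _ h11
  have hl0 : 0 < l := by omega
  refine Nat.le_of_mul_le_mul_left ?_ hl0
  calc l * (2 * #S) ≤ l * Q + 7 * (m + 1) * (4 * (l * l)) := h10.trans (Nat.add_le_add_left h12 _)
    _ = l * (Q + 28 * (m + 1) * l) := by ring

lemma abs_sum_quadraticChar_le_of_eval_zero_ne {f : K[X]} (hf : f.Monic) (hf0 : f.eval 0 ≠ 0)
    (hsq : ¬ ∃ t, f = t ^ 2) (hodd : Odd (Fintype.card K))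
    (hlarge : (4 * f.natDegree + 6) ^ 2 ≤ Fintype.card K) :
    |∑ x, quadraticChar K (f.eval x)| ≤ 28 * (f.natDegree + 1) * Nat.sqrt (Fintype.card K) := by
  obtain ⟨c, hc⟩ := hodd
  have hchar : ringChar K ≠ 2 := by
    intro h
    have := FiniteField.even_card_of_char_two h
    omega
  have hc2 : Fintype.card K / 2 = c := by omega
  have hpow : ∀ x, f.eval x = 0 ∨ f.eval x ≠ 0 ∧
      (quadraticChar K (f.eval x) = 1 ∧ f.eval x ^ c = 1 ∨
        quadraticChar K (f.eval x) = -1 ∧ f.eval x ^ c = -1) := by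
    intro x
    by_cases h : f.eval x = 0
    · exact Or.inl h
    · have h1 := quadraticChar_eq_pow_of_char_ne_two' hchar (f.eval x)
      rw [hc2] at h1
      rcases quadraticChar_dichotomy h with h2 | h2
      · rw [h2] at h1
        exact Or.inr ⟨h, Or.inl ⟨h2, by simpa using h1.symm⟩⟩
      · rw [h2] at h1
        exact Or.inr ⟨h, Or.inr ⟨h2, by simpa using h1.symm⟩⟩
  have h1 := two_mul_card_le_of_pow_eq hf hf0 hsq hc hlarge 1
    (univ.filter fun x => f.eval x = 0 ∨ f.eval x ^ c = 1) (by simp)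
  have h2 := two_mul_card_le_of_pow_eq hf hf0 hsq hc hlarge (-1)
    (univ.filter fun x => f.eval x = 0 ∨ f.eval x ^ c = -1) (by simp)
  have hne : (1 : K) ≠ -1 := fun h => (Ring.neg_one_ne_one_of_char_ne_two hchar) h.symm
  have e1 : ∑ x, quadraticChar K (f.eval x) ≤
      2 * (#(univ.filter fun x => f.eval x = 0 ∨ f.eval x ^ c = 1) : ℤ) - Fintype.card K := by
    rw [Finset.card_filter, ← Finset.card_univ, Finset.card_eq_sum_ones]
    push_cast
    rw [Finset.mul_sum, ← Finset.sum_sub_distrib]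
    refine Finset.sum_le_sum fun x _ => ?_
    rcases hpow x with h | ⟨h, ⟨h3, h4⟩ | ⟨h3, h4⟩⟩
    · simp [h]
    · simp [h3, h4]
    · simp [h, h3, h4, hne.symm]
  have e2 : -∑ x, quadraticChar K (f.eval x) ≤
      2 * (#(univ.filter fun x => f.eval x = 0 ∨ f.eval x ^ c = -1) : ℤ) - Fintype.card K := by
    rw [Finset.card_filter, ← Finset.card_univ, Finset.card_eq_sum_ones]
    push_cast
    rw [Finset.mul_sum, ← Finset.sum_sub_distrib, ← Finset.sum_neg_distrib]
    refine Finset.sum_le_sum fun x _ => ?_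
    rcases hpow x with h | ⟨h, ⟨h3, h4⟩ | ⟨h3, h4⟩⟩
    · simp [h]
    · simp [h, h3, h4, hne]
    · simp [h3, h4]
  rw [abs_le]
  zify at h1 h2
  constructor <;> linarith

/-- A Weil-type bound with a weak constant, by Stepanov's method. -/
theorem abs_sum_quadraticChar_eval_le {f : K[X]} (hf : f.Monic) (hsq : ¬ ∃ t, f = t ^ 2)
    (hodd : Odd (Fintype.card K)) :
    |((∑ x, quadraticChar K (f.eval x) : ℤ) : ℝ)| ≤
      28 * (f.natDegree + 1) * √(Fintype.card K) := by
  by_cases hlarge : (4 * f.natDegree + 6) ^ 2 ≤ Fintype.card K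
  · obtain ⟨t, ht⟩ : ∃ t, f.eval t ≠ 0 := by
      by_contra! h
      have h1 : Fintype.card K ≤ f.natDegree := by
        rw [← Finset.card_univ]
        exact card_le_degree_of_subset_roots fun x _ => by
          simpa [hf.ne_zero] using h x
      nlinarith
    have h1 := abs_sum_quadraticChar_le_of_eval_zero_ne (f := f.comp (X + C t))
      (hf.comp_X_add_C t) (by simpa [eval_comp] using ht) (by
        rintro ⟨s, hs⟩
        refine hsq ⟨s.comp (X - C t), ?_⟩
        rw [← pow_comp, ← hs, comp_assoc]
        simp) hodd (by simpa [natDegree_comp] using hlarge)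
    have h2 : ∑ x, quadraticChar K ((f.comp (X + C t)).eval x) =
        ∑ x, quadraticChar K (f.eval x) := by
      simp only [eval_comp, eval_add, eval_X, eval_C]
      exact Equiv.sum_comp (Equiv.addRight t) fun x => quadraticChar K (f.eval x)
    rw [h2, natDegree_comp, natDegree_X_add_C, mul_one] at h1
    have h3 : ((Nat.sqrt (Fintype.card K) : ℕ) : ℝ) ≤ √(Fintype.card K) := Real.nat_sqrt_le_real_sqrt
    have h4 : |((∑ x, quadraticChar K (f.eval x) : ℤ) : ℝ)| ≤
      28 * (f.natDegree + 1) * (Nat.sqrt (Fintype.card K) : ℕ) := by exact_mod_cast h1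
    exact h4.trans (mul_le_mul_of_nonneg_left h3 (by positivity))
  · have h1 : |∑ x, quadraticChar K (f.eval x)| ≤ Fintype.card K := by
      refine (Finset.abs_sum_le_sum_abs _ _).trans ?_
      rw [← Finset.card_univ, Finset.card_eq_sum_ones]
      push_cast
      refine Finset.sum_le_sum fun x _ => ?_
      by_cases h : f.eval x = 0
      · simp [h]
      · rcases quadraticChar_dichotomy h with h2 | h2 <;> simp [h2]
    have h2 : |((∑ x, quadraticChar K (f.eval x) : ℤ) : ℝ)| ≤ Fintype.card K := by exact_mod_cast h1
    refine h2.trans ?_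
    have h3 : √(Fintype.card K) ≤ 4 * f.natDegree + 6 := by
      rw [Real.sqrt_le_left (by positivity)]
      exact_mod_cast (not_le.1 hlarge).le
    have h4 : √(Fintype.card K : ℝ) * √(Fintype.card K : ℝ) = Fintype.card K :=
      Real.mul_self_sqrt (by positivity)
    have h5 : 0 ≤ √(Fintype.card K : ℝ) := by positivity
    have h6 : (0 : ℝ) ≤ f.natDegree := by positivity
    nlinarith

end Stepanov

section QuadraticSymbol

lemma ringChar_ne_two_of_odd_card {K : Type*} [Field K] [Fintype K] (h : Odd (Fintype.card K)) :
    ringChar K ≠ 2 := by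
  intro h2
  have := FiniteField.even_card_of_char_two h2
  rw [Nat.odd_iff] at h
  omega

lemma quadraticChar_norm {K L : Type*} [Field K] [Fintype K] [DecidableEq K] [Field L] [Fintype L]
    [DecidableEq L] [Algebra K L] (hK : Odd (Fintype.card K)) (y : L) :
    quadraticChar L y = quadraticChar K (Algebra.norm K y) := by
  have hc := Module.card_eq_pow_finrank (K := K) (V := L)
  have hL : Odd (Fintype.card L) := hc ▸ hK.pow
  have hK2 := ringChar_ne_two_of_odd_card hK
  have hL2 := ringChar_ne_two_of_odd_card hL
  have h1 : ((quadraticChar L y : ℤ) : L) = ((quadraticChar K (Algebra.norm K y) : ℤ) : L) := by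
    rw [quadraticChar_eq_pow_of_char_ne_two' hL2]
    have h2 := congrArg (algebraMap K L)
      (quadraticChar_eq_pow_of_char_ne_two' hK2 (Algebra.norm K y))
    rw [map_intCast, map_pow, FiniteField.algebraMap_norm_eq_pow, ← pow_mul] at h2
    rw [h2]
    congr 1
    have hd : Fintype.card K - 1 ∣ Fintype.card L - 1 := by
      rw [hc]; exact Nat.sub_one_dvd_pow_sub_one _ _
    obtain ⟨e, he⟩ := hd
    obtain ⟨k, hk⟩ := hK
    have hk0 : 1 < Fintype.card K := Fintype.one_lt_card
    have hl0 : 1 < Fintype.card L := Fintype.one_lt_card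
    simp only [Nat.card_eq_fintype_card]
    rw [he, Nat.mul_div_cancel_left _ (by omega)]
    have e1 : Fintype.card L = 2 * (e * k) + 1 := by
      have : Fintype.card K - 1 = 2 * k := by omega
      rw [this] at he
      have : 2 * k * e = 2 * (e * k) := by ring
      omega
    have e2 : Fintype.card K / 2 = k := by omega
    rw [e1, e2]
    omega
  exact Int.cast_injOn_of_ringChar_ne_two hL2 (by simpa using quadraticChar_isQuadratic L y)
    (by simpa using quadraticChar_isQuadratic K _) h1

lemma norm_mk_eq_resultant {K : Type*} [Field K] [Finite K] {P : K[X]} (hP : P.Monic)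
    (hirr : Irreducible P) (B : K[X]) :
    Algebra.norm K (AdjoinRoot.mk P B) = resultant P B := by
  have : Fact (Irreducible P) := ⟨hirr⟩
  let Ω := AlgebraicClosure K
  have : FiniteDimensional K (AdjoinRoot P) := hP.finite_adjoinRoot
  apply (algebraMap K Ω).injective
  rw [Algebra.norm_eq_prod_embeddings K Ω, ← resultant_map_map]
  have hs : (P.map (algebraMap K Ω)).Splits := IsAlgClosed.splits _
  have hd : (P.map (algebraMap K Ω)).natDegree = P.natDegree := natDegree_map _
  have hn : (B.map (algebraMap K Ω)).natDegree ≤ B.natDegree := natDegree_map_le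
  rw [← hd, resultant_eq_prod_eval _ _ _ hn hs, (hP.map _).leadingCoeff, one_pow, one_mul]
  have hnodup : (P.aroots Ω).Nodup := nodup_aroots_iff_of_splits hirr.ne_zero hs |>.2
    (PerfectField.separable_of_irreducible hirr)
  change _ = ((P.aroots Ω).map _).prod
  rw [← Multiset.toFinset_val (P.aroots Ω) |>.trans hnodup.dedup]
  change _ = ∏ x ∈ (P.aroots Ω).toFinset, _
  rw [Finset.prod_subtype (p := fun x => x ∈ P.aroots Ω) _ (fun x => by simp)]
  refine Fintype.prod_equiv (AdjoinRoot.equiv Ω K P hirr.ne_zero) _ _ fun σ => ?_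
  have hval : (AdjoinRoot.equiv Ω K P hirr.ne_zero σ : Ω) = σ (AdjoinRoot.root P) := rfl
  rw [hval, eval_map_algebraMap, ← AdjoinRoot.aeval_eq, aeval_algHom_apply]

lemma legSym_eq_quadraticChar_mk (B : F[X]) {P : F[X]} [Fact (Irreducible P)]
    [Fintype (AdjoinRoot P)] :
    legSym F B P = quadraticChar (AdjoinRoot P) (AdjoinRoot.mk P B) := by
  have h1 : AdjoinRoot.mk P B = 0 ↔ P ∣ B := AdjoinRoot.mk_eq_zero
  have h2 : IsSquare (AdjoinRoot.mk P B) ↔ ∃ g : F[X], P ∣ (g ^ 2 - B) := by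
    constructor
    · rintro ⟨y, hy⟩
      obtain ⟨g, rfl⟩ := AdjoinRoot.mk_surjective y
      refine ⟨g, ?_⟩
      rw [← AdjoinRoot.mk_eq_mk, hy, map_pow, sq]
    · rintro ⟨g, hg⟩
      refine ⟨AdjoinRoot.mk P g, ?_⟩
      rw [← map_mul, ← sq, eq_comm, AdjoinRoot.mk_eq_mk]
      exact hg
  rw [quadraticChar_apply, quadraticCharFun, legSym]
  simp only [h1, h2]

lemma legSym_eq_quadraticChar_resultant (hq : Odd (Fintype.card F)) (B : F[X]) {P : F[X]}
    (hP : P.Monic) (hirr : Irreducible P) :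
    legSym F B P = quadraticChar F (resultant P B) := by
  have : Fact (Irreducible P) := ⟨hirr⟩
  have : Finite (AdjoinRoot P) :=
    have := hP.finite_adjoinRoot
    Module.finite_of_finite F
  have := Fintype.ofFinite (AdjoinRoot P)
  rw [legSym_eq_quadraticChar_mk, quadraticChar_norm hq, norm_mk_eq_resultant hP hirr]

lemma quadraticChar_aeval_eq_legSym_pow (hq : Odd (Fintype.card F)) (B : F[X]) {L : Type*}
    [Field L] [Fintype L] [Algebra F L] (x : L) :
    quadraticChar L (aeval x B) =
      legSym F B (minpoly F x) ^ (Module.finrank F L / (minpoly F x).natDegree) := by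
  have hintegral : IsIntegral F x := Algebra.IsIntegral.isIntegral x
  have hirr := minpoly.irreducible hintegral
  have hP := minpoly.monic hintegral
  have : Fact (Irreducible (minpoly F x)) := ⟨hirr⟩
  have : Module.Finite F (AdjoinRoot (minpoly F x)) := hP.finite_adjoinRoot
  have : Finite (AdjoinRoot (minpoly F x)) := Module.finite_of_finite F
  have := Fintype.ofFinite (AdjoinRoot (minpoly F x))
  let φ : AdjoinRoot (minpoly F x) →ₐ[F] L := AdjoinRoot.liftAlgHom _ (Algebra.ofId F L) x
    (minpoly.aeval F x)
  algebraize [φ.toRingHom]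
  have h1 : algebraMap (AdjoinRoot (minpoly F x)) L (AdjoinRoot.mk _ B) = aeval x B := by
    change φ _ = _
    rfl
  have hE : Odd (Fintype.card (AdjoinRoot (minpoly F x))) := by
    rw [Module.card_eq_pow_finrank (K := F)]; exact hq.pow
  rw [← h1, quadraticChar_norm hE, Algebra.norm_algebraMap, map_pow, legSym_eq_quadraticChar_mk]
  congr 1
  have h2 := Module.finrank_mul_finrank F (AdjoinRoot (minpoly F x)) L
  have h3 : Module.finrank F (AdjoinRoot (minpoly F x)) = (minpoly F x).natDegree := by
    rw [(AdjoinRoot.powerBasis' hP).finrank, AdjoinRoot.powerBasis'_dim]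
  rw [h3] at h2
  rw [← h2, Nat.mul_div_cancel_left _ hirr.natDegree_pos]

end QuadraticSymbol

section Resultant

lemma resultant_eq_of_le {K : Type*} [Field K] {B : K[X]} (hB : B.Monic) (g : K[X]) {N : ℕ}
    (hN : g.natDegree ≤ N) : resultant B g B.natDegree N = resultant B g := by
  obtain ⟨k, rfl⟩ := Nat.exists_eq_add_of_le hN
  rw [resultant_add_right_deg _ _ _ _ _ le_rfl, coeff_natDegree, hB.leadingCoeff, one_pow, one_mul]

lemma resultant_add_mul_of_monic {K : Type*} [Field K] {B : K[X]} (hB : B.Monic) (g p : K[X]) :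
    resultant B (g + B * p) = resultant B g := by
  let N := max (g + B * p).natDegree (max g.natDegree (p.natDegree + B.natDegree))
  rw [← resultant_eq_of_le hB (g + B * p) (N := N) (le_max_left _ _),
    ← resultant_eq_of_le hB g (N := N) (le_max_of_le_right (le_max_left _ _)),
    resultant_add_mul_right _ _ _ _ _ (le_max_of_le_right (le_max_right _ _)) le_rfl]

lemma resultant_congr_of_dvd_sub {K : Type*} [Field K] {B : K[X]} (hB : B.Monic) {g h : K[X]}
    (hgh : B ∣ g - h) : resultant B g = resultant B h := by
  obtain ⟨p, hp⟩ := hgh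
  rw [← resultant_add_mul_of_monic hB h p, ← hp]
  congr 1 <;> ring_nf

lemma resultant_mul_of_monic {K : Type*} [Field K] {B : K[X]} (hB : B.Monic) (g h : K[X]) :
    resultant B (g * h) = resultant B g * resultant B h := by
  rw [← resultant_mul_right _ _ _ _ le_rfl, resultant_eq_of_le hB _ natDegree_mul_le]

lemma resultant_mul_left_of_monic {K : Type*} [Field K] {f g : K[X]} (hf : f.Monic)
    (hg : g.Monic) (B : K[X]) :
    resultant (f * g) B = resultant f B * resultant g B := by
  rw [← resultant_mul_left _ _ _ _ le_rfl, hf.natDegree_mul hg]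

lemma exists_irreducible_odd_multiplicity {K : Type*} [Field K] {B : K[X]} (hB : B.Monic)
    (hsq : ¬ ∃ E, B = E ^ 2) :
    ∃ P : K[X], P.Monic ∧ Irreducible P ∧
      ∃ e C, Odd e ∧ B = P ^ e * C ∧ ¬ P ∣ C := by
  by_contra! H
  apply hsq
  have hev : ∀ P ∈ (normalizedFactors B).toFinset, Even ((normalizedFactors B).count P) := by
    intro P hP
    rw [Multiset.mem_toFinset] at hP
    have hirr := irreducible_of_normalized_factor _ hP
    have hmon : P.Monic := by
      rw [← normalize_normalized_factor _ hP]; exact monic_normalize hirr.ne_zero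
    have hfin : FiniteMultiplicity P B := FiniteMultiplicity.of_not_isUnit hirr.not_isUnit hB.ne_zero
    obtain ⟨C, hC, hnd⟩ := hfin.exists_eq_pow_mul_and_not_dvd
    by_contra hodd
    rw [Nat.not_even_iff_odd] at hodd
    have hc : multiplicity P B = (normalizedFactors B).count P := by
      have := emultiplicity_eq_count_normalizedFactors hirr hB.ne_zero
      rw [hmon.normalize_eq_self] at this
      exact multiplicity_eq_of_emultiplicity_eq_some this
    rw [hc] at hC
    exact hnd (H P hmon hirr _ _ hodd hC)
  refine ⟨∏ P ∈ (normalizedFactors B).toFinset, P ^ ((normalizedFactors B).count P / 2), ?_⟩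
  rw [← Finset.prod_pow]
  conv_lhs => rw [← hB.normalize_eq_self, ← prod_normalizedFactors_eq hB.ne_zero,
    Finset.prod_multiset_count]
  refine Finset.prod_congr rfl fun P hP => ?_
  rw [← pow_mul, Nat.div_mul_cancel (hev P hP).two_dvd]

variable {F}

lemma jacSym_eq_quadraticChar_resultant (hq : Odd (Fintype.card F)) (B : F[X]) {f : F[X]}
    (hf : f.Monic) : jacSym F B f = quadraticChar F (resultant f B) := by
  have key : ∀ s : Multiset F[X], (∀ P ∈ s, P.Monic ∧ Irreducible P) →
      (s.map (legSym F B)).prod = quadraticChar F (resultant s.prod B) := by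
    intro s
    induction s using Multiset.induction with
    | empty => intro _; simp
    | cons P s ih =>
      intro hs
      have hs' : ∀ P ∈ s, P.Monic ∧ Irreducible P := fun Q hQ => hs Q (Multiset.mem_cons_of_mem hQ)
      have hP := hs P (Multiset.mem_cons_self _ _)
      rw [Multiset.map_cons, Multiset.prod_cons, Multiset.prod_cons, ih hs',
        legSym_eq_quadraticChar_resultant F hq B hP.1 hP.2, resultant_mul_left_of_monic hP.1,
        map_mul]
      simpa using monic_multiset_prod_of_monic s id (fun Q hQ => (hs' Q hQ).1)
  rw [jacSym, key _ ?_, prod_normalizedFactors_eq hf.ne_zero, hf.normalize_eq_self]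
  intro P hP
  have hirr := irreducible_of_normalized_factor _ hP
  refine ⟨?_, hirr⟩
  rw [← normalize_normalized_factor _ hP]; exact monic_normalize hirr.ne_zero

lemma jacSym_mul (B : F[X]) {f g : F[X]} (hf : f ≠ 0) (hg : g ≠ 0) :
    jacSym F B (f * g) = jacSym F B f * jacSym F B g := by
  rw [jacSym, normalizedFactors_mul hf hg, Multiset.map_add, Multiset.prod_add, jacSym, jacSym]

lemma jacSym_pow (B : F[X]) (f : F[X]) (e : ℕ) :
    jacSym F B (f ^ e) = jacSym F B f ^ e := by
  rw [jacSym, normalizedFactors_pow, Multiset.map_nsmul, Multiset.prod_nsmul, jacSym]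

lemma jacSym_one (B : F[X]) : jacSym F B 1 = 1 := by
  simp [jacSym]

lemma jacSym_of_irreducible (B : F[X]) {P : F[X]} (hP : P.Monic) (hirr : Irreducible P) :
    jacSym F B P = legSym F B P := by
  simp [jacSym, normalizedFactors_irreducible hirr, hP.normalize_eq_self]

lemma abs_jacSym_le_one (B f : F[X]) : |jacSym F B f| ≤ 1 := by
  have h : ∀ P, |legSym F B P| ≤ 1 := fun P => by
    unfold legSym; split_ifs <;> simp
  unfold jacSym
  induction normalizedFactors f using Multiset.induction with
  | empty => simp
  | cons P s ih =>
    rw [Multiset.map_cons, Multiset.prod_cons, abs_mul]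
    exact mul_le_one₀ (h P) (abs_nonneg _) ih

lemma exists_quadraticChar_resultant_eq_neg_one (hq : Odd (Fintype.card F)) {B : F[X]}
    (hB : B.Monic) (hsq : ¬ ∃ E, B = E ^ 2) :
    ∃ u : F[X], quadraticChar F (resultant B u) = -1 := by
  obtain ⟨P, hP, hirr, e, C, he, rfl, hC⟩ := exists_irreducible_odd_multiplicity hB hsq
  have hCm : C.Monic := (hP.pow e).of_mul_monic_left hB
  have : Fact (Irreducible P) := ⟨hirr⟩
  have : Finite (AdjoinRoot P) :=
    have := hP.finite_adjoinRoot
    Module.finite_of_finite F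
  have := Fintype.ofFinite (AdjoinRoot P)
  have hodd : Odd (Fintype.card (AdjoinRoot P)) := by
    have := hP.finite_adjoinRoot
    rw [Module.card_eq_pow_finrank (K := F)]; exact hq.pow
  obtain ⟨y, hy⟩ := quadraticChar_exists_neg_one (ringChar_ne_two_of_odd_card hodd)
  obtain ⟨v, rfl⟩ := AdjoinRoot.mk_surjective y
  obtain ⟨a, b, hab⟩ := (hirr.coprime_iff_not_dvd).2 hC
  refine ⟨1 + (v - 1) * (b * C), ?_⟩
  have h1 : resultant C (1 + (v - 1) * (b * C)) = 1 := by
    rw [resultant_congr_of_dvd_sub hCm (h := 1) ⟨(v - 1) * b, by ring⟩]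
    simp
  have h2 : resultant P (1 + (v - 1) * (b * C)) = resultant P v := by
    apply resultant_congr_of_dvd_sub hP
    refine ⟨(1 - v) * a, ?_⟩
    linear_combination (v - 1) * hab
  rw [resultant_mul_left_of_monic (hP.pow e) hCm, resultant_pow_left _ _ _ _ (by simp [hP.leadingCoeff]) le_rfl,
    h1, h2, mul_one, map_pow, ← legSym_eq_quadraticChar_resultant F hq v hP hirr,
    legSym_eq_quadraticChar_mk, hy, he.neg_one_pow]

end Resultant

section CharacterSums

lemma finite_setOf_natDegree_le (K : Type*) [Field K] [Finite K] (k : ℕ) :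
    {f : K[X] | f.natDegree ≤ k}.Finite := by
  have : Finite (degreeLT K (k + 1)) := Module.finite_of_finite K
  refine (Set.toFinite (degreeLT K (k + 1) : Set K[X])).subset fun f hf => ?_
  rw [SetLike.mem_coe, mem_degreeLT]
  exact (degree_le_of_natDegree_le hf).trans_lt (by exact_mod_cast Nat.lt_succ_self k)

/-- The monic polynomials of degree `k`. -/
def monicsOfDegree (K : Type*) [Field K] [Finite K] (k : ℕ) : Finset K[X] :=
  {f ∈ (finite_setOf_natDegree_le K k).toFinset | f.Monic ∧ f.natDegree = k}

lemma mem_monicsOfDegree {K : Type*} [Field K] [Finite K] {k : ℕ} {f : K[X]} :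
    f ∈ monicsOfDegree K k ↔ f.Monic ∧ f.natDegree = k := by
  simp only [monicsOfDegree, Finset.mem_filter, Set.Finite.mem_toFinset, Set.mem_ofPred_eq]
  exact ⟨fun h => h.2, fun h => ⟨h.2.le, h⟩⟩

/-- The monic irreducible polynomials of degree `k`. -/
def primesOfDegree (K : Type*) [Field K] [Finite K] (k : ℕ) : Finset K[X] :=
  {f ∈ monicsOfDegree K k | Irreducible f}

lemma mem_primesOfDegree {K : Type*} [Field K] [Finite K] {k : ℕ} {f : K[X]} :
    f ∈ primesOfDegree K k ↔ (f.Monic ∧ f.natDegree = k) ∧ Irreducible f := by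
  simp [primesOfDegree, mem_monicsOfDegree]

lemma monicsOfDegree_zero (K : Type*) [Field K] [Finite K] : monicsOfDegree K 0 = {1} := by
  ext f
  rw [mem_monicsOfDegree, Finset.mem_singleton]
  refine ⟨fun h => h.1.natDegree_eq_zero.1 h.2, ?_⟩
  rintro rfl
  simp

variable {F}

lemma sum_jacSym_eq_zero (hq : Odd (Fintype.card F)) {B : F[X]} (hB : B.Monic)
    (hsq : ¬ ∃ E, B = E ^ 2) {k : ℕ} (hk : B.natDegree ≤ k) :
    ∑ f ∈ monicsOfDegree F k, jacSym F B f = 0 := by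
  have hfinite := hB.finite_adjoinRoot
  have : Finite (AdjoinRoot B) := Module.finite_of_finite F
  have := Fintype.ofFinite (AdjoinRoot B)
  obtain ⟨rep, hrep⟩ := (AdjoinRoot.mk_surjective (g := B)).hasRightInverse
  let φ : AdjoinRoot B → ℤ := fun y => quadraticChar F (resultant B (rep y))
  have hφ : ∀ g : F[X], φ (AdjoinRoot.mk B g) = quadraticChar F (resultant B g) := by
    intro g
    simp only [φ]
    rw [resultant_congr_of_dvd_sub hB (AdjoinRoot.mk_eq_mk.1 (hrep (AdjoinRoot.mk B g)))]
  have hsum : ∑ y, φ y = 0 := by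
    obtain ⟨u, hu⟩ := exists_quadraticChar_resultant_eq_neg_one hq hB hsq
    have hunit : IsUnit (AdjoinRoot.mk B u) := by
      have hne : resultant B u ≠ 0 := by
        intro h; rw [h] at hu; simp at hu
      have hco := (isUnit_resultant_iff_isCoprime hB).1 hne.isUnit
      obtain ⟨a, b, hab⟩ := hco
      refine IsUnit.of_mul_eq_one (AdjoinRoot.mk B b) ?_
      rw [← map_mul, ← map_one (AdjoinRoot.mk B), AdjoinRoot.mk_eq_mk]
      exact ⟨-a, by linear_combination hab⟩
    obtain ⟨w, hw⟩ := hunit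
    have h1 : ∑ y, φ y = ∑ y, φ (w * y) := (Equiv.sum_comp (Units.mulLeft w) φ).symm
    have h2 : ∀ y, φ (w * y) = - φ y := by
      intro y
      obtain ⟨g, rfl⟩ := AdjoinRoot.mk_surjective y
      rw [hw, ← map_mul, hφ, hφ, resultant_mul_of_monic hB, map_mul, hu, neg_one_mul]
    simp only [h2, Finset.sum_neg_distrib] at h1
    omega
  have hsgn : ∀ f ∈ monicsOfDegree F k, jacSym F B f =
      quadraticChar F ((-1) ^ (k * B.natDegree)) * φ (AdjoinRoot.mk B f) := by
    intro f hf
    rw [mem_monicsOfDegree] at hf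
    rw [jacSym_eq_quadraticChar_resultant hq B hf.1, hφ, resultant_comm, map_mul, hf.2]
  rw [Finset.sum_congr rfl hsgn, ← Finset.mul_sum]
  have htrans : ∀ y, ∑ f ∈ monicsOfDegree F k, φ (AdjoinRoot.mk B f + y) =
      ∑ f ∈ monicsOfDegree F k, φ (AdjoinRoot.mk B f) := by
    intro y
    obtain ⟨g, rfl⟩ := AdjoinRoot.mk_surjective y
    have hg : AdjoinRoot.mk B g = AdjoinRoot.mk B (g %ₘ B) := by
      rw [AdjoinRoot.mk_eq_mk]
      exact ⟨g /ₘ B, by linear_combination -modByMonic_add_div g B⟩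
    have hlt : (g %ₘ B).degree < k :=
      (degree_modByMonic_lt g hB).trans_le
        ((degree_eq_natDegree hB.ne_zero).le.trans (by exact_mod_cast hk))
    have hmem : ∀ f r : F[X], r.degree < k → f ∈ monicsOfDegree F k →
        f + r ∈ monicsOfDegree F k := by
      intro f r hr hf
      rw [mem_monicsOfDegree] at hf ⊢
      have hr' : r.degree < f.degree := by
        rwa [degree_eq_natDegree hf.1.ne_zero, hf.2]
      exact ⟨hf.1.add_of_left hr', by rw [natDegree_add_eq_left_of_degree_lt hr', hf.2]⟩
    rw [hg]
    refine Finset.sum_bij' (fun f _ => f + g %ₘ B) (fun f _ => f + -(g %ₘ B)) ?_ ?_ ?_ ?_ ?_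
    · exact fun f hf => hmem f _ hlt hf
    · exact fun f hf => hmem f _ (by rwa [degree_neg]) hf
    · intros; ring
    · intros; ring
    · intros; rw [map_add]
  have h3 : (Fintype.card (AdjoinRoot B) : ℤ) *
      ∑ f ∈ monicsOfDegree F k, φ (AdjoinRoot.mk B f) = 0 := by
    rw [← nsmul_eq_mul, ← Finset.card_univ, ← Finset.sum_const,
      ← Finset.sum_congr rfl (fun y _ => htrans y), Finset.sum_comm]
    refine Finset.sum_eq_zero fun f _ => ?_
    rw [← hsum]
    exact Equiv.sum_comp (Equiv.addLeft (AdjoinRoot.mk B f)) φ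
  have : Nonempty (AdjoinRoot B) := ⟨0⟩
  rw [(mul_eq_zero.1 h3).resolve_left (by exact_mod_cast Fintype.card_ne_zero), mul_zero]

end CharacterSums

section Newton

lemma natDegree_eq_sum_prime_powers {K : Type*} [Field K] [Finite K] {f : K[X]} (hf : f.Monic) :
    ∑ d ∈ Icc 1 f.natDegree, ∑ P ∈ primesOfDegree K d, ∑ e ∈ Icc 1 f.natDegree,
      (if P ^ e ∣ f then d else 0) = f.natDegree := by
  have hdisj : (↑(Icc 1 f.natDegree) : Set ℕ).PairwiseDisjoint (primesOfDegree K) := by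
    intro a _ b _ hab
    rw [Function.onFun, Finset.disjoint_left]
    intro P hPa hPb
    rw [mem_primesOfDegree] at hPa hPb
    exact hab (hPa.1.2.symm.trans hPb.1.2)
  have hcount : ∀ P ∈ (Icc 1 f.natDegree).biUnion (primesOfDegree K),
      ∑ e ∈ Icc 1 f.natDegree, (if P ^ e ∣ f then P.natDegree else 0) =
        (normalizedFactors f).count P * P.natDegree := by
    intro P hP
    simp only [Finset.mem_biUnion, mem_primesOfDegree, Finset.mem_Icc] at hP
    obtain ⟨d, hd, ⟨hPm, hPd⟩, hirr⟩ := hP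
    have hdvd : ∀ e, P ^ e ∣ f ↔ e ≤ (normalizedFactors f).count P := by
      intro e
      have := emultiplicity_eq_count_normalizedFactors hirr hf.ne_zero
      rw [hPm.normalize_eq_self] at this
      rw [pow_dvd_iff_le_emultiplicity, this, Nat.cast_le]
    have hle : (normalizedFactors f).count P ≤ f.natDegree := by
      have h1 := natDegree_le_of_dvd ((hdvd _).2 le_rfl) hf.ne_zero
      rw [natDegree_pow] at h1
      exact (Nat.le_mul_of_pos_right _ hirr.natDegree_pos).trans h1
    rw [← Finset.sum_filter, Finset.sum_const, smul_eq_mul]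
    congr 1
    rw [show {e ∈ Icc 1 f.natDegree | P ^ e ∣ f} = Icc 1 ((normalizedFactors f).count P) by
      ext e; simp only [Finset.mem_filter, Finset.mem_Icc, hdvd]; omega]
    simp
  have hstep : ∑ d ∈ Icc 1 f.natDegree, ∑ P ∈ primesOfDegree K d, ∑ e ∈ Icc 1 f.natDegree,
      (if P ^ e ∣ f then d else 0) =
      ∑ P ∈ (Icc 1 f.natDegree).biUnion (primesOfDegree K), ∑ e ∈ Icc 1 f.natDegree,
        (if P ^ e ∣ f then P.natDegree else 0) := by
    rw [Finset.sum_biUnion hdisj]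
    refine Finset.sum_congr rfl fun d _ => Finset.sum_congr rfl fun P hP => ?_
    rw [(mem_primesOfDegree.1 hP).1.2]
  rw [hstep, Finset.sum_congr rfl hcount]
  have hmem : ∀ P ∈ normalizedFactors f, P.Monic ∧ Irreducible P := by
    intro P hP
    have hirr := irreducible_of_normalized_factor _ hP
    refine ⟨?_, hirr⟩
    rw [← normalize_normalized_factor _ hP]; exact monic_normalize hirr.ne_zero
  have hsub : (normalizedFactors f).toFinset ⊆ (Icc 1 f.natDegree).biUnion (primesOfDegree K) := by
    intro P hP
    rw [Multiset.mem_toFinset] at hP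
    have h := hmem P hP
    simp only [Finset.mem_biUnion, mem_primesOfDegree, Finset.mem_Icc]
    exact ⟨P.natDegree, ⟨h.2.natDegree_pos,
      natDegree_le_of_dvd (dvd_of_mem_normalizedFactors hP) hf.ne_zero⟩, ⟨h.1, rfl⟩, h.2⟩
  rw [← Finset.sum_subset hsub fun P _ hP => by
    rw [Multiset.count_eq_zero.2 (by rwa [Multiset.mem_toFinset] at hP), zero_mul]]
  conv_rhs => rw [← hf.normalize_eq_self, ← prod_normalizedFactors_eq hf.ne_zero,
    natDegree_multiset_prod_of_monic _ fun P hP => (hmem P hP).1,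
    Finset.sum_multiset_map_count]
  simp

variable {F}

/-- The sum of `Λ(f) (B/f)` over monic `f` of degree `n`. -/
def primePowerSum (B : F[X]) (n : ℕ) : ℤ :=
  ∑ p ∈ n.divisorsAntidiagonal, ∑ P ∈ primesOfDegree F p.1, p.1 * jacSym F B P ^ p.2

lemma sum_jacSym_filter_pow_dvd (B : F[X]) {P : F[X]} (hP : P.Monic) (e k : ℕ) :
    ∑ f ∈ monicsOfDegree F k with P ^ e ∣ f, jacSym F B f =
      if P.natDegree * e ≤ k then
        jacSym F B P ^ e * ∑ g ∈ monicsOfDegree F (k - P.natDegree * e), jacSym F B g else 0 := by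
  split_ifs with h
  · rw [Finset.mul_sum]
    symm
    refine Finset.sum_bij (fun g _ => P ^ e * g) ?_ ?_ ?_ ?_
    · intro g hg
      rw [mem_monicsOfDegree] at hg
      rw [Finset.mem_filter, mem_monicsOfDegree, (hP.pow e).natDegree_mul hg.1, hP.natDegree_pow,
        hg.2, mul_comm e]
      exact ⟨⟨(hP.pow e).mul hg.1, by omega⟩, dvd_mul_right _ _⟩
    · intro g _ g' _ h
      exact mul_left_cancel₀ (hP.pow e).ne_zero h
    · intro f hf
      rw [Finset.mem_filter, mem_monicsOfDegree] at hf
      obtain ⟨⟨hf1, hf2⟩, g, rfl⟩ := hf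
      have hg : g.Monic := (hP.pow e).of_mul_monic_left hf1
      refine ⟨g, ?_, rfl⟩
      rw [(hP.pow e).natDegree_mul hg, hP.natDegree_pow, mul_comm e] at hf2
      rw [mem_monicsOfDegree]
      exact ⟨hg, by omega⟩
    · intro g hg
      rw [mem_monicsOfDegree] at hg
      rw [jacSym_mul B (hP.pow e).ne_zero hg.1.ne_zero, jacSym_pow]
  · refine Finset.sum_eq_zero fun f hf => absurd ?_ h
    rw [Finset.mem_filter, mem_monicsOfDegree] at hf
    have := natDegree_le_of_dvd hf.2 hf.1.1.ne_zero
    rwa [hP.natDegree_pow, hf.1.2, mul_comm] at this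

lemma newton_identity (B : F[X]) (k : ℕ) :
    (k : ℤ) * ∑ f ∈ monicsOfDegree F k, jacSym F B f =
      ∑ j ∈ Icc 1 k, primePowerSum B j * ∑ f ∈ monicsOfDegree F (k - j), jacSym F B f := by
  set a : ℕ → ℤ := fun k => ∑ f ∈ monicsOfDegree F k, jacSym F B f with ha
  set G : ℕ → ℕ → ℤ := fun d e => ∑ P ∈ primesOfDegree F d, d * jacSym F B P ^ e with hG
  have h1 : (k : ℤ) * a k = ∑ f ∈ monicsOfDegree F k, ∑ d ∈ Icc 1 k, ∑ P ∈ primesOfDegree F d,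
      ∑ e ∈ Icc 1 k, (if P ^ e ∣ f then (d : ℤ) * jacSym F B f else 0) := by
    rw [ha, Finset.mul_sum]
    refine Finset.sum_congr rfl fun f hf => ?_
    rw [mem_monicsOfDegree] at hf
    have := natDegree_eq_sum_prime_powers hf.1
    rw [hf.2] at this
    conv_lhs => rw [← this]
    push_cast
    simp only [Finset.sum_mul, ite_mul, zero_mul]
  have h2 : (k : ℤ) * a k = ∑ d ∈ Icc 1 k, ∑ e ∈ Icc 1 k,
      if d * e ≤ k then G d e * a (k - d * e) else 0 := by
    rw [h1, Finset.sum_comm]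
    refine Finset.sum_congr rfl fun d _ => ?_
    rw [Finset.sum_comm]
    have h3 : ∀ P ∈ primesOfDegree F d, ∑ f ∈ monicsOfDegree F k, ∑ e ∈ Icc 1 k,
        (if P ^ e ∣ f then (d : ℤ) * jacSym F B f else 0) =
        ∑ e ∈ Icc 1 k, if d * e ≤ k then d * jacSym F B P ^ e * a (k - d * e) else 0 := by
      intro P hP
      rw [mem_primesOfDegree] at hP
      rw [Finset.sum_comm]
      refine Finset.sum_congr rfl fun e _ => ?_
      rw [← Finset.sum_filter, ← Finset.mul_sum, sum_jacSym_filter_pow_dvd B hP.1.1, hP.1.2]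
      split_ifs <;> simp [ha, mul_assoc]
    rw [Finset.sum_congr rfl h3, Finset.sum_comm]
    refine Finset.sum_congr rfl fun e _ => ?_
    split_ifs
    · rw [hG, Finset.sum_mul]
    · simp
  change (k : ℤ) * a k = ∑ j ∈ Icc 1 k, primePowerSum B j * a (k - j)
  rw [h2, ← Finset.sum_product', ← Finset.sum_filter]
  have h4 : ∀ j, primePowerSum B j * a (k - j) =
      ∑ p ∈ j.divisorsAntidiagonal, G p.1 p.2 * a (k - p.1 * p.2) := by
    intro j
    rw [primePowerSum, Finset.sum_mul]
    refine Finset.sum_congr rfl fun p hp => ?_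
    rw [(Nat.mem_divisorsAntidiagonal.1 hp).1]
  simp only [h4]
  rw [Finset.sum_sigma']
  symm
  refine Finset.sum_bij' (fun x _ => x.2) (fun p _ => ⟨p.1 * p.2, p⟩) ?_ ?_ ?_ ?_ ?_
  · rintro ⟨j, d, e⟩ h
    simp only [Finset.mem_sigma, Finset.mem_Icc, Nat.mem_divisorsAntidiagonal, Finset.mem_filter,
      Finset.mem_product] at h ⊢
    obtain ⟨⟨h1, h2⟩, rfl, h3⟩ := h
    have hd : 0 < d := Nat.pos_of_ne_zero (by rintro rfl; simp at h3)
    have he : 0 < e := Nat.pos_of_ne_zero (by rintro rfl; simp at h3)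
    exact ⟨⟨⟨hd, (Nat.le_mul_of_pos_right _ he).trans h2⟩, he,
      (Nat.le_mul_of_pos_left _ hd).trans h2⟩, h2⟩
  · rintro ⟨d, e⟩ h
    simp only [Finset.mem_sigma, Finset.mem_Icc, Nat.mem_divisorsAntidiagonal, Finset.mem_filter,
      Finset.mem_product] at h ⊢
    have : 1 ≤ d * e := Nat.mul_pos h.1.1.1 h.1.2.1
    exact ⟨⟨this, h.2⟩, trivial, by omega⟩
  · rintro ⟨j, d, e⟩ h
    simp only [Finset.mem_sigma, Nat.mem_divisorsAntidiagonal] at h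
    obtain ⟨_, rfl, _⟩ := h
    rfl
  · intros; rfl
  · intros; rfl

end Newton

section Extensions

lemma not_square_map {K L : Type*} [Field K] [Finite K] [Field L] [Algebra K L] {B : K[X]}
    (hB : B.Monic) (hsq : ¬ ∃ E, B = E ^ 2) : ¬ ∃ t, B.map (algebraMap K L) = t ^ 2 := by
  rintro ⟨t, ht⟩
  obtain ⟨P, hP, hirr, e, C, he, rfl, hC⟩ := exists_irreducible_odd_multiplicity hB hsq
  have hCm : C.Monic := (hP.pow e).of_mul_monic_left hB
  let Ω := AlgebraicClosure L
  have h0 : (P ^ e * C).map (algebraMap K Ω) = (t.map (algebraMap L Ω)) ^ 2 := by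
    rw [← Polynomial.map_pow, ← ht, Polynomial.map_map, ← IsScalarTower.algebraMap_eq]
  have hs : (P.map (algebraMap K Ω)).Splits := IsAlgClosed.splits _
  obtain ⟨α, hα⟩ := IsAlgClosed.exists_aeval_eq_zero Ω P hirr.degree_pos.ne'
  have hmem : α ∈ P.aroots Ω := (mem_aroots).2 ⟨hirr.ne_zero, hα⟩
  have hnodup : (P.aroots Ω).Nodup := nodup_aroots_iff_of_splits hirr.ne_zero hs |>.2
    (PerfectField.separable_of_irreducible hirr)
  have hnot : α ∉ C.aroots Ω := by
    intro h
    obtain ⟨a, b, hab⟩ := hirr.coprime_iff_not_dvd.2 hC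
    have := congrArg (aeval α) hab
    simp [hα, (mem_aroots.1 h).2] at this
  have h1 : ((P ^ e * C).aroots Ω).count α = e := by
    rw [aroots_mul (mul_ne_zero (pow_ne_zero _ hirr.ne_zero) hCm.ne_zero), aroots_pow,
      Multiset.count_add, Multiset.count_nsmul, Multiset.count_eq_one_of_mem hnodup hmem,
      Multiset.count_eq_zero.2 hnot, mul_one, add_zero]
  rw [aroots_def, h0, roots_pow, Multiset.count_nsmul] at h1
  rw [Nat.odd_iff] at he
  omega

lemma card_filter_minpoly_eq {K L : Type*} [Field K] [Finite K] [Field L] [Fintype L] [Algebra K L]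
    {P : K[X]} (hP : P.Monic) (hirr : Irreducible P) (hd : P.natDegree ∣ Module.finrank K L) :
    #{x : L | minpoly K x = P} = P.natDegree := by
  have : Fact (Irreducible P) := ⟨hirr⟩
  have : Module.Finite K (AdjoinRoot P) := hP.finite_adjoinRoot
  have : Finite (AdjoinRoot P) := Module.finite_of_finite K
  have h3 : Module.finrank K (AdjoinRoot P) = P.natDegree := by
    rw [(AdjoinRoot.powerBasis' hP).finrank, AdjoinRoot.powerBasis'_dim]
  rw [← h3, ← FiniteField.natCard_algHom_of_finrank_dvd (K := AdjoinRoot P) (L := L) (h3 ▸ hd),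
    Nat.card_congr (AdjoinRoot.equiv L K P hirr.ne_zero), ← Fintype.card_subtype,
    Fintype.card_eq_nat_card]
  refine Nat.card_congr (Equiv.subtypeEquivRight fun x => ?_)
  rw [mem_aroots]
  constructor
  · rintro rfl; exact ⟨hirr.ne_zero, minpoly.aeval K x⟩
  · rintro ⟨_, h⟩; exact (minpoly.eq_of_irreducible_of_monic hirr h hP).symm

lemma mul_card_primesOfDegree_le (K : Type*) [Field K] [Fintype K] {n : ℕ} (hn : n ≠ 0) :
    n * #(primesOfDegree K n) ≤ Fintype.card K ^ n := by
  obtain ⟨p, hp⟩ := CharP.exists K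
  have : Fact p.Prime := ⟨CharP.char_is_prime K p⟩
  have : NeZero n := ⟨hn⟩
  let L := FiniteField.Extension K p n
  have := Fintype.ofFinite L
  have hr : Module.finrank K L = n := FiniteField.finrank_extension K p n
  have hc : Fintype.card L = Fintype.card K ^ n := by
    rw [Module.card_eq_pow_finrank (K := K), hr]
  rw [← hc, ← Finset.card_univ, mul_comm]
  refine (Finset.card_nsmul_le_sum (primesOfDegree K n) (fun P => #{x : L | minpoly K x = P}) n
    fun P hP => ?_).trans ?_
  · rw [mem_primesOfDegree] at hP
    rw [card_filter_minpoly_eq hP.1.1 hP.2 (by rw [hP.1.2, hr]), hP.1.2]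
  · rw [← Finset.card_biUnion]
    · exact Finset.card_le_card (Finset.subset_univ _)
    · intro P _ Q _ hPQ
      rw [Function.onFun, Finset.disjoint_left]
      intro x hx hx'
      simp only [Finset.mem_filter] at hx hx'
      exact hPQ (hx.2.symm.trans hx'.2)

variable {F}

lemma primePowerSum_eq_sum_quadraticChar (hq : Odd (Fintype.card F)) (B : F[X]) (L : Type*)
    [Field L] [Fintype L] [Algebra F L] :
    primePowerSum B (Module.finrank F L) = ∑ x : L, quadraticChar L (aeval x B) := by
  set n := Module.finrank F L with hn
  have hn0 : n ≠ 0 := Module.finrank_pos.ne'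
  have hdvd : ∀ x : L, (minpoly F x).natDegree ∣ n := fun x =>
    minpoly.degree_dvd (Algebra.IsIntegral.isIntegral x)
  have hintegral : ∀ x : L, IsIntegral F x := fun x => Algebra.IsIntegral.isIntegral x
  rw [primePowerSum, ← Finset.sum_fiberwise_of_maps_to (s := univ) (t := n.divisorsAntidiagonal)
    (g := fun x : L => ((minpoly F x).natDegree, n / (minpoly F x).natDegree))
    (fun x _ => Nat.mem_divisorsAntidiagonal.2 ⟨Nat.mul_div_cancel' (hdvd x), hn0⟩)]
  refine Finset.sum_congr rfl fun p hp => ?_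
  rw [Nat.mem_divisorsAntidiagonal] at hp
  have hp1 : 0 < p.1 := Nat.pos_of_ne_zero fun h => by simp [h] at hp; omega
  have hp2 : n / p.1 = p.2 := by rw [← hp.1, Nat.mul_div_cancel_left _ hp1]
  rw [← Finset.sum_fiberwise_of_maps_to (t := primesOfDegree F p.1) (g := fun x : L => minpoly F x)]
  · refine Finset.sum_congr rfl fun P hP => ?_
    rw [mem_primesOfDegree] at hP
    rw [Finset.filter_filter]
    have hfil : univ.filter (fun x : L => ((minpoly F x).natDegree, n / (minpoly F x).natDegree) = p ∧
        minpoly F x = P) = univ.filter (fun x : L => minpoly F x = P) := by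
      ext x
      simp only [Finset.mem_filter, Finset.mem_univ, true_and, and_iff_right_iff_imp]
      rintro rfl
      rw [hP.1.2, hp2]
    have hcard : #(univ.filter (fun x : L => minpoly F x = P)) = p.1 := by
      rw [← hP.1.2]
      convert card_filter_minpoly_eq hP.1.1 hP.2 (L := L) ?_
      rw [hP.1.2, ← hn, ← hp.1]; exact dvd_mul_right _ _
    rw [hfil, Finset.sum_congr rfl (g := fun _ => jacSym F B P ^ p.2), Finset.sum_const,
      hcard, nsmul_eq_mul]
    intro x hx
    simp only [Finset.mem_filter, Finset.mem_univ, true_and] at hx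
    rw [quadraticChar_aeval_eq_legSym_pow F hq, hx, hP.1.2, ← hn, hp2,
      jacSym_of_irreducible B hP.1.1 hP.2]
  · intro x hx
    simp only [Finset.mem_filter, Finset.mem_univ, true_and] at hx
    rw [mem_primesOfDegree]
    exact ⟨⟨minpoly.monic (hintegral x), congrArg Prod.fst hx⟩, minpoly.irreducible (hintegral x)⟩

lemma abs_primePowerSum_le_const_mul (hq : Odd (Fintype.card F)) {B : F[X]} (hB : B.Monic)
    (hsq : ¬ ∃ E, B = E ^ 2) {n : ℕ} (hn : n ≠ 0) :
    |(primePowerSum B n : ℝ)| ≤ 28 * (B.natDegree + 1) * √(Fintype.card F) ^ n := by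
  obtain ⟨p, hp⟩ := CharP.exists F
  have : Fact p.Prime := ⟨CharP.char_is_prime F p⟩
  have : NeZero n := ⟨hn⟩
  let L := FiniteField.Extension F p n
  have := Fintype.ofFinite L
  have hr : Module.finrank F L = n := FiniteField.finrank_extension F p n
  have hc : Fintype.card L = Fintype.card F ^ n := by
    rw [Module.card_eq_pow_finrank (K := F), hr]
  have h := abs_sum_quadraticChar_eval_le (hB.map (algebraMap F L)) (not_square_map hB hsq)
    (hc ▸ hq.pow)
  simp only [eval_map_algebraMap, natDegree_map] at h
  rw [hc] at h
  have h2 : √((Fintype.card F ^ n : ℕ) : ℝ) = √(Fintype.card F) ^ n := by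
    rw [Nat.cast_pow]
    refine Real.sqrt_eq_iff_mul_self_eq_of_pos (by positivity) |>.2 ?_
    rw [← mul_pow, Real.mul_self_sqrt (by positivity)]
  rw [h2] at h
  rw [← hr, primePowerSum_eq_sum_quadraticChar hq B L]
  rw [hr]
  convert h using 3

end Extensions

section PowerSums

lemma newton_recurrence_unique {a T S : ℕ → ℂ} (ha : a 0 = 1)
    (hT : ∀ k : ℕ, k * a k = ∑ j ∈ Icc 1 k, T j * a (k - j))
    (hS : ∀ k : ℕ, k * a k = ∑ j ∈ Icc 1 k, S j * a (k - j)) {n : ℕ} (hn : 1 ≤ n) :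
    T n = S n := by
  induction n using Nat.strong_induction_on with
  | _ n ih =>
    have h := (hT n).symm.trans (hS n)
    rw [← Finset.Ico_insert_right hn, Finset.sum_insert (by simp),
      Finset.sum_insert (by simp), Nat.sub_self, ha, mul_one, mul_one] at h
    rw [Finset.sum_congr rfl fun j hj => by
      rw [ih j (Finset.mem_Ico.1 hj).2 (Finset.mem_Ico.1 hj).1]] at h
    exact add_right_cancel h

lemma exists_multiset_power_sums {a T : ℕ → ℂ} {N : ℕ} (ha : a 0 = 1) (hN : ∀ k, N < k → a k = 0)
    (hT : ∀ k : ℕ, k * a k = ∑ j ∈ Icc 1 k, T j * a (k - j)) :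
    ∃ s : Multiset ℂ, Multiset.card s = N ∧
      ∀ n, 1 ≤ n → T n = -(s.map (· ^ n)).sum := by
  let p : ℂ[X] := ∑ k ∈ range (N + 1), C (a k) * X ^ (N - k)
  have hcoeff : ∀ k ≤ N, p.coeff (N - k) = a k := by
    intro k hk
    simp only [p, finsetSum_coeff, coeff_C_mul, coeff_X_pow, mul_ite, mul_one, mul_zero]
    rw [Finset.sum_eq_single k]
    · simp
    · intro b hb hbk
      rw [Finset.mem_range] at hb
      rw [if_neg (by omega)]
    · intro h; simp at h; omega
  have hle : p.natDegree ≤ N := by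
    refine natDegree_sum_le_of_forall_le _ _ fun k _ => ?_
    exact (natDegree_C_mul_X_pow_le _ _).trans (Nat.sub_le _ _)
  have hpN : p.coeff N = 1 := by simpa [ha] using hcoeff 0 (Nat.zero_le _)
  have hdeg : p.natDegree = N := le_antisymm hle (le_natDegree_of_ne_zero (by simp [hpN]))
  have hmon : p.Monic := by rw [Monic, leadingCoeff, hdeg, hpN]
  have hcard : Multiset.card p.roots = N := by
    rw [← hdeg]; exact splits_iff_card_roots.1 (IsAlgClosed.splits p)
  have hesymm : ∀ k, (-1) ^ k * p.roots.esymm k = a k := by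
    intro k
    by_cases hk : k ≤ N
    · rw [← hcoeff k hk, coeff_eq_esymm_roots_of_card (hcard.trans hdeg.symm)
        (by rw [hdeg]; exact Nat.sub_le _ _), hmon.leadingCoeff, one_mul, hdeg,
        Nat.sub_sub_self hk]
    · rw [hN k (by omega), Multiset.esymm, Multiset.powersetCard_eq_empty _ (by omega)]
      simp
  refine ⟨p.roots, hcard, fun n hn => ?_⟩
  refine newton_recurrence_unique ha hT (S := fun n => -(p.roots.map (· ^ n)).sum) ?_ hn
  intro k
  let f : p.roots.ToType → ℂ := fun x => x.1
  have hf : univ.val.map f = p.roots := Multiset.map_univ_coe _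
  have hnewton := congrArg (MvPolynomial.aeval f) (MvPolynomial.mul_esymm_eq_sum p.roots.ToType ℂ k)
  have hps : ∀ j, MvPolynomial.aeval f (MvPolynomial.psum p.roots.ToType ℂ j) =
      (p.roots.map (· ^ j)).sum := by
    intro j
    rw [MvPolynomial.psum, map_sum]
    conv_rhs => rw [← hf, Multiset.map_map]
    simp [f]
  simp only [map_mul, map_natCast, map_sum, map_pow, map_neg, map_one,
    MvPolynomial.aeval_esymm_eq_multiset_esymm, hf, hps] at hnewton
  rw [← hesymm k, mul_left_comm, hnewton, ← mul_assoc, ← pow_add, Finset.mul_sum]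
  symm
  refine Finset.sum_bij (fun j _ => (k - j, j)) ?_ ?_ ?_ ?_
  · intro j hj
    simp only [Finset.mem_Icc] at hj
    simp only [Finset.mem_filter, HasAntidiagonal.mem_antidiagonal]
    omega
  · intro i hi j hj h
    exact congrArg Prod.snd h
  · rintro ⟨i, j⟩ h
    simp only [Finset.mem_filter, HasAntidiagonal.mem_antidiagonal] at h
    refine ⟨j, by simp only [Finset.mem_Icc]; omega, ?_⟩
    ext <;> simp; omega
  · intro j hj
    rw [← hesymm]
    have : (-1 : ℂ) ^ (k + (k + 1)) = -1 := Odd.neg_one_pow ⟨k, by ring⟩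
    rw [this]
    ring

lemma sum_coeff_mul_power_sum (s : Multiset ℂ) (P : ℂ[X]) (n : ℕ) :
    ∑ j ∈ range (P.natDegree + 1), P.coeff j * (s.map (· ^ (n + j))).sum =
      (s.map fun α => α ^ n * P.eval α).sum := by
  induction s using Multiset.induction with
  | empty => simp
  | cons α s ih =>
    simp only [Multiset.map_cons, Multiset.sum_cons, mul_add, Finset.sum_add_distrib, ih]
    congr 1
    rw [eval_eq_sum_range, Finset.mul_sum]
    exact Finset.sum_congr rfl fun j _ => by ring

lemma norm_le_of_power_sums_le {s : Multiset ℂ} {C R : ℝ} (hR : 0 < R)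
    (h : ∀ n, 1 ≤ n → ‖(s.map (· ^ n)).sum‖ ≤ C * R ^ n) {β : ℂ} (hβ : β ∈ s) : ‖β‖ ≤ R := by
  let P : ℂ[X] := ∏ γ ∈ s.toFinset.erase β, (X - Polynomial.C γ)
  have hPβ : P.eval β ≠ 0 := by
    rw [eval_prod, Finset.prod_ne_zero_iff]
    intro γ hγ
    simpa [sub_eq_zero] using (Finset.ne_of_mem_erase hγ).symm
  have hP0 : ∀ α ∈ s, α ≠ β → P.eval α = 0 := by
    intro α hα hne
    rw [eval_prod]
    exact Finset.prod_eq_zero (Finset.mem_erase.2 ⟨hne, Multiset.mem_toFinset.2 hα⟩) (by simp)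
  have hkey : ∀ n, (s.map fun α => α ^ n * P.eval α).sum = s.count β * (β ^ n * P.eval β) := by
    intro n
    rw [Finset.sum_multiset_map_count, Finset.sum_eq_single β]
    · rw [nsmul_eq_mul]
    · intro b hb hne
      rw [hP0 b (Multiset.mem_toFinset.1 hb) hne, mul_zero, smul_zero]
    · intro h; exact absurd (Multiset.mem_toFinset.2 hβ) h
  have hc : 0 < (s.count β : ℝ) * ‖P.eval β‖ :=
    mul_pos (by exact_mod_cast Multiset.count_pos.2 hβ) (norm_pos_iff.2 hPβ)
  set D : ℝ := ∑ j ∈ range (P.natDegree + 1), ‖P.coeff j‖ * (C * R ^ j) with hD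
  have hbound : ∀ n, 1 ≤ n → (s.count β * ‖P.eval β‖) * ‖β‖ ^ n ≤ D * R ^ n := by
    intro n hn
    calc (s.count β * ‖P.eval β‖) * ‖β‖ ^ n = ‖(s.count β : ℂ) * (β ^ n * P.eval β)‖ := by
          simp; ring
      _ = ‖∑ j ∈ range (P.natDegree + 1), P.coeff j * (s.map (· ^ (n + j))).sum‖ := by
          rw [sum_coeff_mul_power_sum, hkey]
      _ ≤ ∑ j ∈ range (P.natDegree + 1), ‖P.coeff j‖ * (C * R ^ (n + j)) := by
          refine norm_sum_le_of_le _ fun j _ => ?_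
          rw [norm_mul]
          exact mul_le_mul_of_nonneg_left (h _ (by omega)) (norm_nonneg _)
      _ = D * R ^ n := by
          rw [hD, Finset.sum_mul]
          exact Finset.sum_congr rfl fun j _ => by ring
  by_contra! hlt
  have h1 : 1 < ‖β‖ / R := (one_lt_div hR).2 hlt
  obtain ⟨n, hn⟩ := pow_unbounded_of_one_lt (D / (s.count β * ‖P.eval β‖)) h1
  have h2 : D / (s.count β * ‖P.eval β‖) < (‖β‖ / R) ^ (n + 1) :=
    hn.trans_le (pow_le_pow_right₀ h1.le (Nat.le_succ n))
  rw [div_pow, div_lt_div_iff₀ hc (by positivity)] at h2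
  have := hbound (n + 1) (by omega)
  linarith

lemma norm_sum_pow_le {s : Multiset ℂ} {R : ℝ} (h : ∀ β ∈ s, ‖β‖ ≤ R) (n : ℕ) :
    ‖(s.map (· ^ n)).sum‖ ≤ Multiset.card s * R ^ n := by
  induction s using Multiset.induction with
  | empty => simp
  | cons α s ih =>
    rw [Multiset.map_cons, Multiset.sum_cons, Multiset.card_cons]
    have h1 := ih fun β hβ => h β (Multiset.mem_cons_of_mem hβ)
    have h2 : ‖α ^ n‖ ≤ R ^ n := by
      rw [norm_pow]
      exact pow_le_pow_left₀ (norm_nonneg _) (h α (Multiset.mem_cons_self _ _)) n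
    push_cast
    linarith [norm_add_le (α ^ n) (s.map (· ^ n)).sum]

end PowerSums

section WeilBound

variable {F}

lemma abs_primePowerSum_le (hq : Odd (Fintype.card F)) {B : F[X]} (hB : B.Monic)
    (hdeg : 0 < B.natDegree) (hsq : ¬ ∃ E, B = E ^ 2) {n : ℕ} (hn : 1 ≤ n) :
    |(primePowerSum B n : ℝ)| ≤ B.natDegree * √(Fintype.card F) ^ n := by
  let a : ℕ → ℂ := fun k => ((∑ f ∈ monicsOfDegree F k, jacSym F B f : ℤ) : ℂ)
  have hR : 0 < √(Fintype.card F : ℝ) := Real.sqrt_pos.2 (by exact_mod_cast Fintype.card_pos)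
  obtain ⟨s, hs, hT⟩ := exists_multiset_power_sums (a := a)
    (T := fun j => (primePowerSum B j : ℂ)) (N := B.natDegree - 1)
    (by simp [a, monicsOfDegree_zero, jacSym_one])
    (fun k hk => by
      simp only [a]
      rw [sum_jacSym_eq_zero hq hB hsq (by omega), Int.cast_zero])
    (fun k => by simp only [a]; exact_mod_cast newton_identity B k)
  have hnorm : ∀ n, 1 ≤ n → ‖(s.map (· ^ n)).sum‖ = |(primePowerSum B n : ℝ)| := by
    intro n hn
    rw [← norm_neg, ← hT n hn, Complex.norm_intCast]
  have hβ : ∀ β ∈ s, ‖β‖ ≤ √(Fintype.card F : ℝ) := fun β => norm_le_of_power_sums_le hR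
    fun n hn => (hnorm n hn).trans_le (abs_primePowerSum_le_const_mul hq hB hsq (by omega))
  rw [← hnorm n hn]
  refine (norm_sum_pow_le hβ n).trans ?_
  rw [hs]
  gcongr
  exact Nat.sub_le _ _

lemma sum_range_pow_le {q : ℕ} (hq : 2 ≤ q) (M : ℕ) :
    ∑ d ∈ range (M + 1), q ^ d ≤ 2 * q ^ M := by
  induction M with
  | zero => simp
  | succ M ih =>
    rw [Finset.sum_range_succ, pow_succ]
    nlinarith [Nat.zero_le (q ^ M)]

lemma abs_sum_primes_le (hq : Odd (Fintype.card F)) {B : F[X]} (hB : B.Monic)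
    (hdeg : 0 < B.natDegree) (hsq : ¬ ∃ E, B = E ^ 2) {n : ℕ} (hn : 1 ≤ n) :
    n * |((∑ P ∈ primesOfDegree F n, jacSym F B P : ℤ) : ℝ)| ≤
      (B.natDegree + 2) * √(Fintype.card F) ^ n := by
  set q := Fintype.card F with hqdef
  have hq2 : 2 ≤ q := Fintype.one_lt_card
  let G : ℕ × ℕ → ℤ := fun p => ∑ P ∈ primesOfDegree F p.1, p.1 * jacSym F B P ^ p.2
  have hmem : (n, 1) ∈ n.divisorsAntidiagonal := by
    rw [Nat.mem_divisorsAntidiagonal]; exact ⟨mul_one n, by omega⟩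
  have hsplit : primePowerSum B n = n * ∑ P ∈ primesOfDegree F n, jacSym F B P +
      ∑ p ∈ n.divisorsAntidiagonal.erase (n, 1), G p := by
    rw [primePowerSum, ← Finset.add_sum_erase _ _ hmem]
    simp [G, Finset.mul_sum]
  have hG : ∀ p ∈ n.divisorsAntidiagonal.erase (n, 1), |G p| ≤ (q : ℤ) ^ p.1 := by
    intro p hp
    rw [Finset.mem_erase, Nat.mem_divisorsAntidiagonal] at hp
    have hp0 : p.1 ≠ 0 := fun h => by simp [h] at hp; omega
    calc |G p| ≤ ∑ P ∈ primesOfDegree F p.1, (p.1 : ℤ) := by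
          refine (Finset.abs_sum_le_sum_abs _ _).trans (Finset.sum_le_sum fun P _ => ?_)
          rw [abs_mul, abs_pow, Nat.abs_cast]
          exact mul_le_of_le_one_right (by positivity)
            (pow_le_one₀ (abs_nonneg _) (abs_jacSym_le_one B P))
      _ = ((p.1 * #(primesOfDegree F p.1) : ℕ) : ℤ) := by simp [mul_comm]
      _ ≤ (q : ℤ) ^ p.1 := by exact_mod_cast mul_card_primesOfDegree_le F hp0
  have hrest : |∑ p ∈ n.divisorsAntidiagonal.erase (n, 1), G p| ≤ 2 * (q : ℤ) ^ (n / 2) := by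
    have hinj : Set.InjOn Prod.fst (↑(n.divisorsAntidiagonal.erase (n, 1)) : Set (ℕ × ℕ)) := by
      rintro ⟨d, e⟩ h ⟨d', e'⟩ h' heq
      rw [Finset.mem_coe, Finset.mem_erase, Nat.mem_divisorsAntidiagonal] at h h'
      simp only at h h' heq
      subst heq
      have hd : 0 < d := Nat.pos_of_ne_zero fun h0 => by simp [h0] at h; omega
      rw [Nat.eq_of_mul_eq_mul_left hd (h.2.1.trans h'.2.1.symm)]
    have hsub : (n.divisorsAntidiagonal.erase (n, 1)).image Prod.fst ⊆ range (n / 2 + 1) := by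
      intro d hd
      rw [Finset.mem_image] at hd
      obtain ⟨⟨d, e⟩, h, rfl⟩ := hd
      rw [Finset.mem_erase, Nat.mem_divisorsAntidiagonal] at h
      simp only at h
      have he1 : e ≠ 1 := fun h1 => h.1 (by rw [h1, mul_one] at h; rw [h1, h.2.1])
      have he0 : e ≠ 0 := fun h0 => by simp [h0] at h; omega
      have he : 2 ≤ e := by omega
      rw [Finset.mem_range, Nat.lt_succ_iff, Nat.le_div_iff_mul_le two_pos, ← h.2.1]
      exact Nat.mul_le_mul_left d he
    calc |∑ p ∈ n.divisorsAntidiagonal.erase (n, 1), G p|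
        ≤ ∑ p ∈ n.divisorsAntidiagonal.erase (n, 1), (q : ℤ) ^ p.1 :=
          (Finset.abs_sum_le_sum_abs _ _).trans (Finset.sum_le_sum hG)
      _ = ∑ d ∈ (n.divisorsAntidiagonal.erase (n, 1)).image Prod.fst, (q : ℤ) ^ d :=
          (Finset.sum_image hinj).symm
      _ ≤ ∑ d ∈ range (n / 2 + 1), (q : ℤ) ^ d :=
          Finset.sum_le_sum_of_subset_of_nonneg hsub fun _ _ _ => by positivity
      _ ≤ 2 * (q : ℤ) ^ (n / 2) := by exact_mod_cast sum_range_pow_le hq2 (n / 2)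
  have hpow : (q : ℝ) ^ (n / 2) ≤ √q ^ n := by
    have h1 : (1 : ℝ) ≤ √q := Real.one_le_sqrt.2 (by exact_mod_cast (by omega : 1 ≤ q))
    calc (q : ℝ) ^ (n / 2) = √q ^ (2 * (n / 2)) := by
          rw [pow_mul, Real.sq_sqrt (by positivity)]
      _ ≤ √q ^ n := pow_le_pow_right₀ h1 (Nat.mul_div_le n 2)
  have hrest' : |((∑ p ∈ n.divisorsAntidiagonal.erase (n, 1), G p : ℤ) : ℝ)| ≤
      2 * (q : ℝ) ^ (n / 2) := by exact_mod_cast hrest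
  have hmain := abs_primePowerSum_le hq hB hdeg hsq hn
  have hsplit' : (n : ℝ) * ((∑ P ∈ primesOfDegree F n, jacSym F B P : ℤ) : ℝ) =
      (primePowerSum B n : ℝ) -
        ((∑ p ∈ n.divisorsAntidiagonal.erase (n, 1), G p : ℤ) : ℝ) := by
    rw [hsplit, Int.cast_add, Int.cast_mul, Int.cast_natCast]; ring
  calc (n : ℝ) * |((∑ P ∈ primesOfDegree F n, jacSym F B P : ℤ) : ℝ)|
      = |(n : ℝ) * ((∑ P ∈ primesOfDegree F n, jacSym F B P : ℤ) : ℝ)| := by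
        rw [abs_mul, Nat.abs_cast]
    _ ≤ |(primePowerSum B n : ℝ)| +
        |((∑ p ∈ n.divisorsAntidiagonal.erase (n, 1), G p : ℤ) : ℝ)| := by
        rw [hsplit']; exact norm_sub_le (E := ℝ) _ _
    _ ≤ _ := by linarith

end WeilBound

/-- Weil bound for character sums over primes: if B is monic of positive degree
and not a perfect square, then for all n ≥ 1,
|Σ_{P monic prime, deg P = n} (B/P)| ≤ ((deg B + 1)/n) q^{n/2} + 2 q^{n/2}/n. -/
theorem statement18 (hq : Odd (Fintype.card F)) (B : F[X]) (hB : B.Monic)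
    (hdeg : 0 < B.natDegree) (hsq : ¬∃ E : F[X], B = E ^ 2) (n : ℕ) (hn : 1 ≤ n) :
    |(∑ᶠ P ∈ {P : F[X] | P.Monic ∧ Irreducible P ∧ P.natDegree = n},
        (jacSym F B P : ℝ))| ≤
      ((B.natDegree + 1 : ℝ) / n) * (Fintype.card F : ℝ) ^ ((n : ℝ) / 2) +
        2 * (Fintype.card F : ℝ) ^ ((n : ℝ) / 2) / n := by
  have hset : {P : F[X] | P.Monic ∧ Irreducible P ∧ P.natDegree = n} = ↑(primesOfDegree F n) := by
    ext P
    rw [Finset.mem_coe, mem_primesOfDegree, Set.mem_ofPred_eq]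
    tauto
  have hpow : (Fintype.card F : ℝ) ^ ((n : ℝ) / 2) = √(Fintype.card F) ^ n := by
    rw [Real.sqrt_eq_rpow, ← Real.rpow_natCast, ← Real.rpow_mul (by positivity)]
    ring_nf
  have hn0 : (0 : ℝ) < n := by exact_mod_cast hn
  have hmain := abs_sum_primes_le hq hB hdeg hsq hn
  have hR : 0 ≤ √(Fintype.card F : ℝ) ^ n := by positivity
  rw [hset, finsum_mem_coe_finset, hpow, div_mul_eq_mul_div, ← add_div, le_div_iff₀ hn0]
  push_cast at hmain
  linarith
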